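/- Fix ω ∈ (0,2π). Define, for z in the closed sector |arg z| ≤ ω/2 minus the origin, v^{−2}(z) = (1/(2π)) sin ω log² z + (1/(2π)) sin ω log² z̄ − (1/π)(sin ω + (2π − ω) cos ω) log z − z^{−1} z̄, and, for z₊ in the closed sector |arg z₊| ≤ π − ω/2 minus the origin, w^{−2}(z₊) = (1/(2π)) sin ω log² z₊ + (1/(2π)) sin ω log² z̄₊ − (1/π)(sin ω + (π − ω) cos ω) log z₊ − cos ω · log z̄₊ − cos ω + (π − ω) sin ω. Then: ∂_z∂_{z̄} v^{−2}(z) = z^{−2} for all z ∈ S₋; ∂_{z₊}∂_{z̄₊} w^{−2}(z₊) = 0 for all z₊ with |arg z₊| < π − ω/2; and for all z ∈ Γ (with z₊ = −z): z ∂_z v^{−2}(z) − z̄ ∂_{z̄} v^{−2}(z) − z₊ (∂_{z₊} w^{−2})(z₊) + z̄₊ (∂_{z̄₊} w^{−2})(z₊) = 0 and v^{−2}(z) = w^{−2}(z₊). -/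

import Mathlib

open Complex ComplexConjugate Filter Set
open scoped Real

noncomputable section

/-- The Wirtinger derivative `∂_z f = ½(∂_x f − i ∂_y f)`. -/
def wdz (f : ℂ → ℂ) (z : ℂ) : ℂ :=
  (fderiv ℝ f z 1 - I * fderiv ℝ f z I) / 2

/-- The Wirtinger derivative `∂_{z̄} f = ½(∂_x f + i ∂_y f)`. -/
def wdzbar (f : ℂ → ℂ) (z : ℂ) : ℂ :=
  (fderiv ℝ f z 1 + I * fderiv ℝ f z I) / 2

/-- The open sector `S₋ = {r e^{iθ} : r > 0, |θ| < ω/2}`. -/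
def Sminus (ω : ℝ) : Set ℂ := {z | z ≠ 0 ∧ |z.arg| < ω / 2}

/-- The open sector of the variable `z₊ = −z`, i.e. `{z₊ ≠ 0 : |arg z₊| < π − ω/2}`,
corresponding to the interior of `S₊`. -/
def SplusVar (ω : ℝ) : Set ℂ := {z | z ≠ 0 ∧ |z.arg| < π - ω / 2}

/-- The common boundary `Γ = {r e^{±iω/2} : r > 0}`. -/
def Gam (ω : ℝ) : Set ℂ := {z | z ≠ 0 ∧ |z.arg| = ω / 2}

/-- `f` is real-differentiable at `z` with differential `a dz + b dz̄`. -/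
def HasWirtingerAt (f : ℂ → ℂ) (a b z : ℂ) : Prop :=
  HasFDerivAt f (a • ContinuousLinearMap.id ℝ ℂ + b • (conjCLE : ℂ →L[ℝ] ℂ)) z

namespace HasWirtingerAt

variable {f g : ℂ → ℂ} {a b a' b' z : ℂ}

lemma wdz_eq (h : HasWirtingerAt f a b z) : wdz f z = a := by
  unfold HasWirtingerAt at h
  simp only [wdz, h.fderiv]
  simp
  linear_combination (b - a) / 2 * I_mul_I

lemma wdzbar_eq (h : HasWirtingerAt f a b z) : wdzbar f z = b := by
  unfold HasWirtingerAt at h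
  simp only [wdzbar, h.fderiv]
  simp
  linear_combination (a - b) / 2 * I_mul_I

lemma add (hf : HasWirtingerAt f a b z) (hg : HasWirtingerAt g a' b' z) :
    HasWirtingerAt (fun x => f x + g x) (a + a') (b + b') z := by
  refine (HasFDerivAt.add hf hg).congr_fderiv ?_
  refine ContinuousLinearMap.ext fun x => ?_
  simp
  ring

lemma sub (hf : HasWirtingerAt f a b z) (hg : HasWirtingerAt g a' b' z) :
    HasWirtingerAt (fun x => f x - g x) (a - a') (b - b') z := by
  refine (HasFDerivAt.sub hf hg).congr_fderiv ?_
  refine ContinuousLinearMap.ext fun x => ?_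
  simp
  ring

lemma mul (hf : HasWirtingerAt f a b z) (hg : HasWirtingerAt g a' b' z) :
    HasWirtingerAt (fun x => f x * g x) (f z * a' + g z * a) (f z * b' + g z * b) z := by
  refine (HasFDerivAt.mul hf hg).congr_fderiv ?_
  refine ContinuousLinearMap.ext fun x => ?_
  simp
  ring

lemma congr_of_eventuallyEq (hf : HasWirtingerAt f a b z) (h : g =ᶠ[nhds z] f) :
    HasWirtingerAt g a b z :=
  HasFDerivAt.congr_of_eventuallyEq hf h

end HasWirtingerAt

lemma HasDerivAt.hasWirtingerAt {f : ℂ → ℂ} {f' z : ℂ} (h : HasDerivAt f f' z) :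
    HasWirtingerAt f f' 0 z := by
  refine (h.hasFDerivAt.restrictScalars ℝ).congr_fderiv ?_
  refine ContinuousLinearMap.ext fun x => ?_
  simp [mul_comm]

lemma HasDerivAt.hasWirtingerAt_comp_conj {f : ℂ → ℂ} {f' z : ℂ}
    (h : HasDerivAt f f' (conj z)) : HasWirtingerAt (fun x => f (conj x)) 0 f' z := by
  refine ((h.hasFDerivAt.restrictScalars ℝ).comp z
    (conjCLE : ℂ →L[ℝ] ℂ).hasFDerivAt).congr_fderiv ?_
  refine ContinuousLinearMap.ext fun x => ?_
  simp [mul_comm]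

lemma conj_mem_slitPlane {z : ℂ} (hz : z ∈ slitPlane) : conj z ∈ slitPlane := by
  simpa [mem_slitPlane_iff] using hz

/-- The common form of the shadow functions in the two sectors. -/
def logShadow (A B C D E z : ℂ) : ℂ :=
  A * log z ^ 2 + A * log (conj z) ^ 2 - B * log z - C * log (conj z) - D * (z⁻¹ * conj z) + E

lemma hasWirtingerAt_logShadow (A B C D E : ℂ) {z : ℂ} (hz : z ∈ slitPlane) :
    HasWirtingerAt (logShadow A B C D E)
      (2 * A * log z / z - B / z + D * conj z / z ^ 2)
      (2 * A * log (conj z) / conj z - C / conj z - D / z) z := by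
  have h0 := slitPlane_ne_zero hz
  have h0' := slitPlane_ne_zero (conj_mem_slitPlane hz)
  have h1 := (((hasDerivAt_log hz).pow 2).const_mul A).hasWirtingerAt
  have h2 := (((hasDerivAt_log (conj_mem_slitPlane hz)).pow 2).const_mul A).hasWirtingerAt_comp_conj
  have h3 := ((hasDerivAt_log hz).const_mul B).hasWirtingerAt
  have h4 := ((hasDerivAt_log (conj_mem_slitPlane hz)).const_mul C).hasWirtingerAt_comp_conj
  have h5 := ((hasDerivAt_inv h0).const_mul D).hasWirtingerAt.mul
    (hasDerivAt_id (conj z)).hasWirtingerAt_comp_conj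
  have h6 := (hasDerivAt_const z E).hasWirtingerAt
  have h := ((((h1.add h2).sub h3).sub h4).sub h5).add h6
  convert h using 1
  · funext x
    simp only [logShadow, id, Pi.pow_apply]
    ring
  · simp
    field_simp
  · simp
    field_simp

lemma wdz_wdzbar_logShadow (A B C D E : ℂ) {z : ℂ} (hz : z ∈ slitPlane) :
    wdz (wdzbar (logShadow A B C D E)) z = D * z ^ (-2 : ℤ) := by
  have h0 := slitPlane_ne_zero hz
  have hc := conj_mem_slitPlane hz
  have h0' := slitPlane_ne_zero hc
  have h1 := ((((hasDerivAt_log hc).const_mul (2 * A)).sub_const C).div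
    (hasDerivAt_id (conj z)) h0').hasWirtingerAt_comp_conj
  have h2 := ((hasDerivAt_inv h0).const_mul D).hasWirtingerAt
  have h := (h1.sub h2).congr_of_eventuallyEq (g := wdzbar (logShadow A B C D E)) (by
    filter_upwards [isOpen_slitPlane.mem_nhds hz] with x hx
    rw [(hasWirtingerAt_logShadow A B C D E hx).wdzbar_eq]
    simp only [Pi.div_apply, id]
    ring)
  rw [h.wdz_eq, zpow_neg]
  norm_cast
  ring

lemma mem_slitPlane_of_abs_arg_lt {z : ℂ} (h0 : z ≠ 0) (h : |z.arg| < π) : z ∈ slitPlane :=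
  mem_slitPlane_iff_arg.2 ⟨fun h' => by simp [h', abs_of_pos Real.pi_pos] at h, h0⟩

/-- The Neumann and Dirichlet transmission conditions, in terms of the values of the logarithms
and of `u = z⁻¹ * conj z` on the half-line `arg z = ε * ω / 2`, where `ε = ± 1`. -/
lemma logShadow_transmission {z A B B' C E ε s c p ω L : ℂ} (hp : p ≠ 0) (hε : ε ^ 2 = 1)
    (hz : z ∈ slitPlane) (hz' : -z ∈ slitPlane)
    (hA : A = s / (2 * p)) (hB : B = (s + (2 * p - ω) * c) / p)
    (hB' : B' = (s + (p - ω) * c) / p) (hC : C = c) (hE : E = -c + (p - ω) * s)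
    (hl : log z = L + ε * (ω / 2) * I) (hlc : log (conj z) = L - ε * (ω / 2) * I)
    (hm : log (-z) = L + ε * (ω / 2 - p) * I)
    (hmc : log (conj (-z)) = L - ε * (ω / 2 - p) * I)
    (hu : z⁻¹ * conj z = c - ε * s * I) :
    z * wdz (logShadow A B 0 1 0) z - conj z * wdzbar (logShadow A B 0 1 0) z
        - (-z) * wdz (logShadow A B' C 0 E) (-z)
        + conj (-z) * wdzbar (logShadow A B' C 0 E) (-z) = 0 ∧
      logShadow A B 0 1 0 z = logShadow A B' C 0 E (-z) := by
  have h0 := slitPlane_ne_zero hz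
  have h0' := slitPlane_ne_zero (conj_mem_slitPlane hz)
  have hv := hasWirtingerAt_logShadow A B 0 1 0 hz
  have hw := hasWirtingerAt_logShadow A B' C 0 E hz'
  constructor
  · rw [hv.wdz_eq, hv.wdzbar_eq, hw.wdz_eq, hw.wdzbar_eq]
    have key : 2 * A * log z - B - 2 * A * log (conj z) - 2 * A * log (-z) + B'
        + 2 * A * log (conj (-z)) - C + 2 * (z⁻¹ * conj z) = 0 := by
      rw [hl, hlc, hm, hmc, hu, hA, hB, hB', hC]
      field_simp
      ring
    refine Eq.trans ?_ key
    simp only [map_neg]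
    field_simp
    ring
  · simp only [logShadow]
    rw [hu, hl, hlc, hm, hmc, hA, hB, hB', hC, hE]
    field_simp
    ring_nf
    simp only [hε, I_sq]
    ring

/-- The first-order shadow generated by `z^{−2}` (Proposition `prop:k-2`),
with the transmission conditions of problem `eq:shadowdualPart`. -/
theorem stmt12 (ω : ℝ) (hω : ω ∈ Ioo 0 (2 * π))
    (v w : ℂ → ℂ)
    (hv : ∀ z : ℂ, v z =
      ((1 / (2 * π) : ℝ) : ℂ) * (Real.sin ω : ℂ) * (Complex.log z) ^ 2
      + ((1 / (2 * π) : ℝ) : ℂ) * (Real.sin ω : ℂ) * (Complex.log (conj z)) ^ 2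
      - ((1 / π : ℝ) : ℂ) * ((Real.sin ω : ℂ) + ((2 * π - ω : ℝ) : ℂ) * (Real.cos ω : ℂ))
          * Complex.log z
      - z ^ (-1 : ℤ) * conj z)
    (hw : ∀ z : ℂ, w z =
      ((1 / (2 * π) : ℝ) : ℂ) * (Real.sin ω : ℂ) * (Complex.log z) ^ 2
      + ((1 / (2 * π) : ℝ) : ℂ) * (Real.sin ω : ℂ) * (Complex.log (conj z)) ^ 2
      - ((1 / π : ℝ) : ℂ) * ((Real.sin ω : ℂ) + ((π - ω : ℝ) : ℂ) * (Real.cos ω : ℂ))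
          * Complex.log z
      - (Real.cos ω : ℂ) * Complex.log (conj z)
      - (Real.cos ω : ℂ) + (((π - ω) * Real.sin ω : ℝ) : ℂ)) :
    (∀ z ∈ Sminus ω, wdz (wdzbar v) z = z ^ (-2 : ℤ)) ∧
    (∀ zp ∈ SplusVar ω, wdz (wdzbar w) zp = 0) ∧
    (∀ z ∈ Gam ω,
      z * wdz v z - conj z * wdzbar v z
        - (-z) * wdz w (-z) + conj (-z) * wdzbar w (-z) = 0 ∧
      v z = w (-z)) := by
  obtain ⟨hω0, hω2⟩ := hω
  have hv' : v = logShadow ((Real.sin ω : ℂ) / (2 * (π : ℂ)))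
      (((Real.sin ω : ℂ) + (2 * (π : ℂ) - ω) * (Real.cos ω : ℂ)) / π) 0 1 0 := by
    funext z
    rw [hv, logShadow, zpow_neg_one]
    push_cast
    ring
  have hw' : w = logShadow ((Real.sin ω : ℂ) / (2 * (π : ℂ)))
      (((Real.sin ω : ℂ) + ((π : ℂ) - ω) * (Real.cos ω : ℂ)) / π) (Real.cos ω : ℂ) 0
      (-(Real.cos ω : ℂ) + ((π : ℂ) - ω) * (Real.sin ω : ℂ)) := by
    funext z
    rw [hw, logShadow]
    push_cast
    ring
  refine ⟨?_, ?_, ?_⟩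
  · rintro z ⟨h0, hz⟩
    rw [hv', wdz_wdzbar_logShadow _ _ _ _ _ (mem_slitPlane_of_abs_arg_lt h0 (by linarith)), one_mul]
  · rintro z ⟨h0, hz⟩
    rw [hw', wdz_wdzbar_logShadow _ _ _ _ _ (mem_slitPlane_of_abs_arg_lt h0 (by linarith)),
      zero_mul]
  · rintro z ⟨h0, hz⟩
    obtain ⟨ε, hε, hε', harg, harg'⟩ : ∃ ε : ℝ, (ε = 1 ∨ ε = -1) ∧ ε ^ 2 = 1 ∧
        z.arg = ε * (ω / 2) ∧ (-z).arg = ε * (ω / 2 - π) := by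
      rcases (abs_eq (by linarith)).1 hz with h | h
      · refine ⟨1, .inl rfl, by norm_num, by linarith, ?_⟩
        have him : 0 < z.im := by
          rw [← norm_mul_sin_arg, h]
          exact mul_pos (norm_pos_iff.2 h0)
            (Real.sin_pos_of_pos_of_lt_pi (by linarith) (by linarith))
        rw [arg_neg_eq_arg_sub_pi_of_im_pos him, h]
        ring
      · refine ⟨-1, .inr rfl, by norm_num, by linarith, ?_⟩
        have him : z.im < 0 := by
          rw [← norm_mul_sin_arg, h, Real.sin_neg]
          exact mul_neg_of_pos_of_neg (norm_pos_iff.2 h0)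
            (neg_neg_of_pos (Real.sin_pos_of_pos_of_lt_pi (by linarith) (by linarith)))
        rw [arg_neg_eq_arg_add_pi_of_im_neg him, h]
        ring
    have hs : z ∈ slitPlane := mem_slitPlane_of_abs_arg_lt h0 (by linarith)
    have hs' : -z ∈ slitPlane := by
      refine mem_slitPlane_of_abs_arg_lt (neg_ne_zero.2 h0) ?_
      rw [harg', abs_lt]
      rcases hε with rfl | rfl <;> constructor <;> linarith
    have hl : log z = (Real.log ‖z‖ : ℂ) + (ε : ℂ) * ((ω : ℂ) / 2) * I := by
      rw [log, harg]
      push_cast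
      ring
    have hm : log (-z) = (Real.log ‖z‖ : ℂ) + (ε : ℂ) * ((ω : ℂ) / 2 - π) * I := by
      rw [log, harg', norm_neg]
      push_cast
      ring
    have hlc : log (conj z) = (Real.log ‖z‖ : ℂ) - (ε : ℂ) * ((ω : ℂ) / 2) * I := by
      rw [log_conj _ (mem_slitPlane_iff_arg.1 hs).1, hl]
      simp [conj_ofReal, map_ofNat, sub_eq_add_neg]
    have hmc : log (conj (-z)) = (Real.log ‖z‖ : ℂ) - (ε : ℂ) * ((ω : ℂ) / 2 - π) * I := by
      rw [log_conj _ (mem_slitPlane_iff_arg.1 hs').1, hm]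
      simp [conj_ofReal, map_ofNat, sub_eq_add_neg]
    have hu : z⁻¹ * conj z = (Real.cos ω : ℂ) - (ε : ℂ) * (Real.sin ω : ℂ) * I := by
      have : z⁻¹ * conj z = exp (-(ε * ω : ℝ) * I) := by
        have h1 : z⁻¹ = exp (-log z) := by rw [exp_neg, exp_log h0]
        have h2 : conj z = exp (log (conj z)) :=
          (exp_log (slitPlane_ne_zero (conj_mem_slitPlane hs))).symm
        rw [h1, h2, ← exp_add, hl, hlc]
        congr 1
        push_cast
        ring
      rw [this, exp_mul_I]
      rcases hε with rfl | rfl <;> simp [sub_eq_add_neg]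
    rw [hv', hw']
    exact logShadow_transmission (ofReal_ne_zero.2 Real.pi_ne_zero) (by exact_mod_cast hε') hs hs'
      rfl rfl rfl rfl rfl hl hlc hm hmc hu
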